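/- Let R be a staircase with at least two blocks and m steps, and let r = [x1,x2]×[y1,y2] ∈ R be a deletable rectangle of type (0,0) whose top edge lies on the j-th step of R. Then R ∖ {r} is a staircase with exactly m−1 steps. -/

import Mathlib

open Set

/-- A block is a closed axis-parallel rectangle `[x1,x2] × [y1,y2]` with `x1 < x2`, `y1 < y2`. -/
def IsBlock (b : Set (ℝ × ℝ)) : Prop :=
  ∃ x1 x2 y1 y2 : ℝ, x1 < x2 ∧ y1 < y2 ∧ b = Icc x1 x2 ×ˢ Icc y1 y2

/-- `R` is a staircase with `m` steps, step x-coordinates `a 0 < a 1 < ⋯ < a m`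
(with `a 0 = 0`) and step heights `h 1 > h 2 > ⋯ > h m > 0`. -/
def IsStaircaseWith (R : Finset (Set (ℝ × ℝ))) (m : ℕ) (a h : ℕ → ℝ) : Prop :=
  R.Nonempty ∧
  (∀ b ∈ R, IsBlock b) ∧
  (∀ b ∈ R, ∀ b' ∈ R, b ≠ b' → interior b ∩ interior b' = ∅) ∧
  (∀ (p : ℝ × ℝ) (b1 b2 b3 b4 : Set (ℝ × ℝ)),
      b1 ∈ R → b2 ∈ R → b3 ∈ R → b4 ∈ R →
      p ∈ b1 → p ∈ b2 → p ∈ b3 → p ∈ b4 →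
      b1 = b2 ∨ b1 = b3 ∨ b1 = b4 ∨ b2 = b3 ∨ b2 = b4 ∨ b3 = b4) ∧
  1 ≤ m ∧
  a 0 = 0 ∧
  (∀ j, j < m → a j < a (j + 1)) ∧
  (∀ j, 1 ≤ j → j < m → h (j + 1) < h j) ∧
  0 < h m ∧
  ⋃₀ (R : Set (Set (ℝ × ℝ))) =
    ⋃ j ∈ Finset.Icc 1 m, Icc (a (j - 1)) (a j) ×ˢ Icc (0 : ℝ) (h j)

/-- `R` is a staircase. -/
def IsStaircase (R : Finset (Set (ℝ × ℝ))) : Prop :=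
  ∃ m a h, IsStaircaseWith R m a h

/-- `r` is a deletable rectangle of `R`: a block of `R` whose top edge and right
edge are both contained in the topological boundary of `⋃ R`. -/
def IsDeletable (R : Finset (Set (ℝ × ℝ))) (r : Set (ℝ × ℝ)) : Prop :=
  r ∈ R ∧ ∃ x1 x2 y1 y2 : ℝ, x1 < x2 ∧ y1 < y2 ∧ r = Icc x1 x2 ×ˢ Icc y1 y2 ∧
    (Icc x1 x2 ×ˢ ({y2} : Set ℝ)) ⊆ frontier (⋃₀ (R : Set (Set (ℝ × ℝ)))) ∧
    (({x2} : Set ℝ) ×ˢ Icc y1 y2) ⊆ frontier (⋃₀ (R : Set (Set (ℝ × ℝ))))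

/-- A mosaic floorplan is a staircase with exactly one step. -/
def IsMosaicFloorplan (M : Finset (Set (ℝ × ℝ))) : Prop :=
  ∃ a h, IsStaircaseWith M 1 a h

noncomputable instance : DecidableEq (Set (ℝ × ℝ)) := Classical.decEq _

theorem IsBlock.isClosed {b : Set (ℝ × ℝ)} (hb : IsBlock b) : IsClosed b := by
  obtain ⟨x1, x2, y1, y2, -, -, rfl⟩ := hb
  exact isClosed_Icc.prod isClosed_Icc

theorem IsBlock.closure_interior {b : Set (ℝ × ℝ)} (hb : IsBlock b) :
    closure (interior b) = b := by
  obtain ⟨x1, x2, y1, y2, hx, hy, rfl⟩ := hb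
  rw [interior_prod_eq, interior_Icc, interior_Icc, closure_prod_eq, closure_Ioo hx.ne,
    closure_Ioo hy.ne]

theorem IsBlock.nonempty {b : Set (ℝ × ℝ)} (hb : IsBlock b) : b.Nonempty := by
  obtain ⟨x1, x2, y1, y2, hx, hy, rfl⟩ := hb
  exact ⟨(x1, y1), ⟨le_rfl, hx.le⟩, ⟨le_rfl, hy.le⟩⟩

theorem IsBlock.subset_of_subset_union {b r C : Set (ℝ × ℝ)} (hb : IsBlock b) (hr : IsBlock r)
    (hdisj : interior b ∩ interior r = ∅) (hC : IsClosed C) (hsub : b ⊆ C ∪ r) : b ⊆ C := by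
  have hbr : Disjoint (interior b) r := by
    rw [← hr.closure_interior]
    exact (disjoint_iff_inter_eq_empty.mpr hdisj).closure_right isOpen_interior
  rw [← hb.closure_interior]
  refine closure_minimal (fun p hp => ?_) hC
  exact (hsub (interior_subset hp)).resolve_right (disjoint_left.mp hbr hp)

/-- The sequence `f` with its `j`-th term removed. -/
def skipAt (j : ℕ) (f : ℕ → ℝ) (i : ℕ) : ℝ := if i < j then f i else f (i + 1)

theorem skipAt_of_lt {j i : ℕ} (f : ℕ → ℝ) (hi : i < j) : skipAt j f i = f i := if_pos hi

theorem skipAt_of_le {j i : ℕ} (f : ℕ → ℝ) (hi : j ≤ i) : skipAt j f i = f (i + 1) :=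
  if_neg hi.not_gt

theorem skipAt_rel_succ {s : ℝ → ℝ → Prop} [IsTrans ℝ s] {f : ℕ → ℝ} {n m : ℕ} (j : ℕ)
    (hf : ∀ i, n ≤ i → i < m → s (f i) (f (i + 1))) {i : ℕ} (hn : n ≤ i) (hi : i < m - 1) :
    s (skipAt j f i) (skipAt j f (i + 1)) := by
  rcases lt_trichotomy (i + 1) j with hij | hij | hij
  · rw [skipAt_of_lt f (by omega), skipAt_of_lt f hij]
    exact hf i hn (by omega)
  · rw [skipAt_of_lt f (by omega), skipAt_of_le f hij.ge]
    exact _root_.trans (hf i hn (by omega)) (hf (i + 1) (by omega) (by omega))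
  · rw [skipAt_of_le f (by omega), skipAt_of_le f hij.le]
    exact hf (i + 1) (by omega) (by omega)

theorem skipAt_lt_succ {a : ℕ → ℝ} {m : ℕ} (j : ℕ) (ha : ∀ i, i < m → a i < a (i + 1))
    (i : ℕ) (hi : i < m - 1) : skipAt j a i < skipAt j a (i + 1) :=
  skipAt_rel_succ (s := (· < ·)) j (fun i _ => ha i) i.zero_le hi

theorem skipAt_succ_lt {h : ℕ → ℝ} {m : ℕ} (j : ℕ)
    (hh : ∀ i, 1 ≤ i → i < m → h (i + 1) < h i) (i : ℕ) (hi1 : 1 ≤ i) (hi : i < m - 1) :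
    skipAt j h (i + 1) < skipAt j h i :=
  skipAt_rel_succ (s := (· > ·)) j hh hi1 hi

theorem le_of_steps_lt {m : ℕ} {a : ℕ → ℝ} (ha : ∀ j, j < m → a j < a (j + 1)) {i k : ℕ}
    (hik : i ≤ k) (hk : k ≤ m) : a i ≤ a k := by
  induction k, hik using Nat.le_induction with
  | base => exact le_rfl
  | succ k _ ih => exact (ih (by omega)).trans (ha k (by omega)).le

theorem heights_le_of_le {m : ℕ} {h : ℕ → ℝ} (hh : ∀ j, 1 ≤ j → j < m → h (j + 1) < h j)
    {i k : ℕ} (hi : 1 ≤ i) (hik : i ≤ k) (hk : k ≤ m) : h k ≤ h i := by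
  induction k, hik using Nat.le_induction with
  | base => exact le_rfl
  | succ k _ ih => exact (hh k (by omega) (by omega)).le.trans (ih (by omega))

theorem skipAt_heights_pos {m : ℕ} {h : ℕ → ℝ} (j : ℕ)
    (hh : ∀ j, 1 ≤ j → j < m → h (j + 1) < h j) (hpos : 0 < h m) {i : ℕ} (hi : 1 ≤ i)
    (him : i ≤ m - 1) : 0 < skipAt j h i := by
  rw [skipAt]
  split_ifs
  · exact hpos.trans_le (heights_le_of_le hh hi (by omega) le_rfl)
  · exact hpos.trans_le (heights_le_of_le hh (by omega) (by omega) le_rfl)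

/-- The region under the steps with abscissae `a` and heights `h`. -/
def stepRegion (m : ℕ) (a h : ℕ → ℝ) : Set (ℝ × ℝ) :=
  ⋃ j ∈ Finset.Icc 1 m, Icc (a (j - 1)) (a j) ×ˢ Icc (0 : ℝ) (h j)

theorem mem_stepRegion {m : ℕ} {a h : ℕ → ℝ} {x y : ℝ} :
    (x, y) ∈ stepRegion m a h ↔
      ∃ i, 1 ≤ i ∧ i ≤ m ∧ a (i - 1) ≤ x ∧ x ≤ a i ∧ 0 ≤ y ∧ y ≤ h i := by
  simp only [stepRegion, mem_iUnion, mem_prod, mem_Icc, Finset.mem_Icc, exists_prop, and_assoc]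

theorem isClosed_stepRegion (m : ℕ) (a h : ℕ → ℝ) : IsClosed (stepRegion m a h) :=
  isClosed_biUnion_finset fun _ _ => isClosed_Icc.prod isClosed_Icc

theorem stepRegion_subset_skipAt_union {m j : ℕ} {a h : ℕ → ℝ}
    (ha : ∀ j, j < m → a j < a (j + 1)) (hj1 : 1 ≤ j) (hjm : j ≤ m) :
    stepRegion m a h ⊆ stepRegion (m - 1) (skipAt j a) (skipAt j h) ∪
      Icc (a (j - 1)) (a j) ×ˢ Icc (if j < m then h (j + 1) else 0) (h j) := by
  rintro ⟨x, y⟩ hp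
  obtain ⟨i, hi1, him, hx1, hx2, hy1, hy2⟩ := mem_stepRegion.mp hp
  rcases lt_trichotomy i j with hij | rfl | hij
  · refine Or.inl (mem_stepRegion.mpr ⟨i, hi1, by omega, ?_⟩)
    rw [skipAt_of_lt a hij, skipAt_of_lt h hij, skipAt_of_lt a (by omega)]
    exact ⟨hx1, hx2, hy1, hy2⟩
  · by_cases hy : (if i < m then h (i + 1) else 0) ≤ y
    · exact Or.inr ⟨⟨hx1, hx2⟩, hy, hy2⟩
    · split_ifs at hy with hm
      · refine Or.inl (mem_stepRegion.mpr ⟨i, hi1, by omega, ?_⟩)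
        rw [skipAt_of_le a le_rfl, skipAt_of_le h le_rfl, skipAt_of_lt a (by omega)]
        exact ⟨hx1, hx2.trans (ha i hm).le, hy1, (not_le.mp hy).le⟩
      · exact absurd hy1 hy
  · obtain ⟨k, rfl⟩ : ∃ k, i = k + 1 := ⟨i - 1, by omega⟩
    refine Or.inl (mem_stepRegion.mpr ⟨k, by omega, by omega, ?_⟩)
    rw [skipAt_of_le a (show j ≤ k by omega), skipAt_of_le h (by omega)]
    refine ⟨le_trans ?_ hx1, hx2, hy1, hy2⟩
    rw [skipAt]
    split_ifs
    · exact le_of_steps_lt ha (by omega) (by omega)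
    · exact le_of_steps_lt ha (by omega) (by omega)

theorem stepRegion_skipAt_subset {m j : ℕ} {a h : ℕ → ℝ}
    (hh : ∀ j, 1 ≤ j → j < m → h (j + 1) < h j) (hj1 : 1 ≤ j) :
    stepRegion (m - 1) (skipAt j a) (skipAt j h) ⊆ stepRegion m a h := by
  rintro ⟨x, y⟩ hp
  obtain ⟨i, hi1, him, hx1, hx2, hy1, hy2⟩ := mem_stepRegion.mp hp
  rw [mem_stepRegion]
  rcases lt_trichotomy i j with hij | rfl | hij
  · rw [skipAt_of_lt a hij] at hx2
    rw [skipAt_of_lt h hij] at hy2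
    rw [skipAt_of_lt a (by omega)] at hx1
    exact ⟨i, hi1, by omega, hx1, hx2, hy1, hy2⟩
  · rw [skipAt_of_le a le_rfl] at hx2
    rw [skipAt_of_le h le_rfl] at hy2
    rw [skipAt_of_lt a (by omega)] at hx1
    rcases le_total x (a i) with hx | hx
    · exact ⟨i, hi1, by omega, hx1, hx, hy1, hy2.trans (hh i hi1 (by omega)).le⟩
    · exact ⟨i + 1, by omega, by omega, hx, hx2, hy1, hy2⟩
  · rw [skipAt_of_le a hij.le] at hx2
    rw [skipAt_of_le h hij.le] at hy2
    rw [skipAt_of_le a (by omega), Nat.sub_add_cancel hi1] at hx1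
    exact ⟨i + 1, by omega, by omega, hx1, hx2, hy1, hy2⟩

theorem sUnion_erase_eq {R : Finset (Set (ℝ × ℝ))} {m j : ℕ} {a h : ℕ → ℝ}
    {r : Set (ℝ × ℝ)} (hR : IsStaircaseWith R m a h) (hr : r ∈ R) (hj1 : 1 ≤ j) (hjm : j ≤ m)
    (hrj : r = Icc (a (j - 1)) (a j) ×ˢ Icc (if j < m then h (j + 1) else 0) (h j)) :
    ⋃₀ (R.erase r : Set (Set (ℝ × ℝ))) = stepRegion (m - 1) (skipAt j a) (skipAt j h) := by
  obtain ⟨-, hblock, hdisj, -, -, -, ha, hh, hpos, hU⟩ := hR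
  change _ = stepRegion m a h at hU
  apply Subset.antisymm
  · refine sUnion_subset fun b hb => ?_
    obtain ⟨hbr, hbR⟩ := Finset.mem_erase.mp (Finset.mem_coe.mp hb)
    refine (hblock b hbR).subset_of_subset_union (hblock r hr) (hdisj b hbR r hr hbr)
      (isClosed_stepRegion _ _ _) ?_
    have hbU : b ⊆ stepRegion m a h := hU ▸ subset_sUnion_of_mem (Finset.mem_coe.mpr hbR)
    rw [hrj]
    exact hbU.trans (stepRegion_subset_skipAt_union ha hj1 hjm)
  · have hclosed : IsClosed (⋃₀ (R.erase r : Set (Set (ℝ × ℝ)))) :=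
      by
      rw [sUnion_eq_biUnion]
      exact (Finset.finite_toSet _).isClosed_biUnion fun b hb =>
        (hblock b (Finset.mem_of_mem_erase (Finset.mem_coe.mp hb))).isClosed
    have hcover : stepRegion (m - 1) (skipAt j a) (skipAt j h) ⊆
        ⋃₀ (R.erase r : Set (Set (ℝ × ℝ))) ∪ r := by
      intro p hp
      have hpU := stepRegion_skipAt_subset hh hj1 hp
      rw [← hU] at hpU
      obtain ⟨b, hb, hpb⟩ := hpU
      by_cases hbr : b = r
      · exact Or.inr (hbr ▸ hpb)
      · exact Or.inl ⟨b, Finset.mem_coe.mpr (Finset.mem_erase.mpr ⟨hbr, hb⟩), hpb⟩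
    refine iUnion₂_subset fun i hi => ?_
    have hsub := (subset_biUnion_of_mem (u := fun i =>
      Icc (skipAt j a (i - 1)) (skipAt j a i) ×ˢ Icc (0 : ℝ) (skipAt j h i))
      (show i ∈ {i | i ∈ Finset.Icc 1 (m - 1)} from hi)).trans hcover
    obtain ⟨hi1, him⟩ := Finset.mem_Icc.mp hi
    refine IsBlock.subset_of_subset_union ?_ (hblock r hr) ?_ hclosed hsub
    · refine ⟨_, _, _, _, ?_, skipAt_heights_pos j hh hpos hi1 him, rfl⟩
      have := skipAt_lt_succ j ha (i - 1) (by omega)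
      rwa [Nat.sub_add_cancel hi1] at this
    · rw [hrj, eq_empty_iff_forall_notMem]
      simp only [interior_prod_eq, interior_Icc]
      rintro ⟨x, y⟩ ⟨⟨⟨-, hx⟩, ⟨-, hy⟩⟩, ⟨⟨hx', -⟩, ⟨hy', -⟩⟩⟩
      dsimp only at hx hy hx' hy'
      rcases lt_or_ge i j with hij | hij
      · rw [skipAt_of_lt a hij] at hx
        have := le_of_steps_lt ha (show i ≤ j - 1 by omega) (by omega)
        linarith
      · rw [skipAt_of_le h hij] at hy
        rw [if_pos (by omega)] at hy'
        have := heights_le_of_le hh (show 1 ≤ j + 1 by omega)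
          (show j + 1 ≤ i + 1 by omega) (by omega)
        linarith

/-- Let `R` be a staircase with at least two blocks and `m`
steps, and let `r = [x1,x2] × [y1,y2] ∈ R` be a deletable rectangle of type
`(0,0)` whose top edge lies on the `j`-th step of `R` (so `y2 = h j` and
`x2 = a j`; here `h'` is `h (j+1)` if `j < m` and `0` if `j = m`).
Then `R \ {r}` is a staircase with exactly `m − 1` steps. -/
theorem erase_type00_steps (R : Finset (Set (ℝ × ℝ))) (m : ℕ) (a h : ℕ → ℝ)
    (hR : IsStaircaseWith R m a h) (hcard : 2 ≤ R.card)
    (x1 x2 y1 y2 : ℝ) (hx : x1 < x2) (hy : y1 < y2)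
    (hr : IsDeletable R (Icc x1 x2 ×ˢ Icc y1 y2))
    (j : ℕ) (hj1 : 1 ≤ j) (hjm : j ≤ m)
    (htop : y2 = h j) (hright : x2 = a j)
    (htype1 : x1 = a (j - 1))
    (htype2 : y1 = (if j < m then h (j + 1) else 0)) :
    ∃ a' h', IsStaircaseWith (R.erase (Icc x1 x2 ×ˢ Icc y1 y2)) (m - 1) a' h' := by
  set r := Icc x1 x2 ×ˢ Icc y1 y2 with hrdef
  have hrR : r ∈ R := hr.1
  have hrj : r = Icc (a (j - 1)) (a j) ×ˢ Icc (if j < m then h (j + 1) else 0) (h j) := by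
    rw [hrdef, htop, hright, htype1, htype2]
  have hU := sUnion_erase_eq hR hrR hj1 hjm hrj
  obtain ⟨-, hblock, hdisj, hfour, -, ha0, ha, hh, hpos, -⟩ := hR
  have hne : (R.erase r).Nonempty := by
    rw [← Finset.card_pos, Finset.card_erase_of_mem hrR]
    omega
  have hm : 1 ≤ m - 1 := by
    obtain ⟨b, hb⟩ := hne
    obtain ⟨⟨x, y⟩, hp⟩ := (hblock b (Finset.mem_of_mem_erase hb)).nonempty
    have hpU : (x, y) ∈ ⋃₀ (R.erase r : Set (Set (ℝ × ℝ))) := ⟨b, Finset.mem_coe.mpr hb, hp⟩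
    rw [hU] at hpU
    obtain ⟨i, hi1, him, -⟩ := mem_stepRegion.mp hpU
    omega
  refine ⟨skipAt j a, skipAt j h, hne, fun b hb => hblock b (Finset.mem_of_mem_erase hb),
    fun b hb b' hb' => hdisj b (Finset.mem_of_mem_erase hb) b' (Finset.mem_of_mem_erase hb'),
    fun p b1 b2 b3 b4 h1 h2 h3 h4 => hfour p b1 b2 b3 b4 (Finset.mem_of_mem_erase h1)
      (Finset.mem_of_mem_erase h2) (Finset.mem_of_mem_erase h3) (Finset.mem_of_mem_erase h4),
    hm, ?_, skipAt_lt_succ j ha, skipAt_succ_lt j hh, skipAt_heights_pos j hh hpos hm le_rfl, hU⟩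
  rw [skipAt_of_lt a hj1, ha0]
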